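/- (Subadditivity under decomposition.) For any product-form subspace T ⊆ E_0, one has D(c,d,B) ≤ D(c,d,B_T) + D(c,d,B_{E_0/T}) and D_g(c,d,B) ≤ D_g(c,d,B_T) + D_g(c,d,B_{E_0/T}). -/

import Mathlib

open MeasureTheory LinearMap
open scoped RealInnerProductSpace BigOperators NNReal ENNReal

noncomputable section

namespace FRBL

/-- A positive semidefinite (self-adjoint) operator on a real inner product space. -/
def PosSemidef {G : Type*} [NormedAddCommGroup G] [InnerProductSpace ℝ G]
    (A : G →ₗ[ℝ] G) : Prop :=
  A.IsSymmetric ∧ ∀ x : G, 0 ≤ ⟪A x, x⟫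

/-- A positive definite (self-adjoint) operator on a real inner product space. -/
def PosDef {G : Type*} [NormedAddCommGroup G] [InnerProductSpace ℝ G]
    (A : G →ₗ[ℝ] G) : Prop :=
  A.IsSymmetric ∧ ∀ x : G, x ≠ 0 → 0 < ⟪A x, x⟫

variable {k m : ℕ}
  (E : Fin k → Type*) (F : Fin m → Type*)
  [∀ i, NormedAddCommGroup (E i)] [∀ i, InnerProductSpace ℝ (E i)]
  [∀ i, FiniteDimensional ℝ (E i)]
  [∀ i, MeasurableSpace (E i)] [∀ i, BorelSpace (E i)]
  [∀ j, NormedAddCommGroup (F j)] [∀ j, InnerProductSpace ℝ (F j)]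
  [∀ j, FiniteDimensional ℝ (F j)]
  [∀ j, MeasurableSpace (F j)] [∀ j, BorelSpace (F j)]
  (c : Fin k → ℝ) (d : Fin m → ℝ)
  (B : ∀ i j, E i →ₗ[ℝ] F j)

/-- The pointwise domination hypothesis of the forward-reverse Brascamp-Lieb inequality. -/
def Hyp (f : ∀ i, E i → ℝ≥0) (g : ∀ j, F j → ℝ≥0) : Prop :=
  ∀ x : ∀ i, E i,
    (∏ i, f i (x i) ^ c i) ≤ ∏ j, g j (∑ i, c i • B i j (x i)) ^ d j

/-- `D₀` is an admissible constant for the forward-reverse Brascamp-Lieb inequality. -/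
def IsBound (D₀ : ℝ) : Prop :=
  ∀ (f : ∀ i, E i → ℝ≥0) (g : ∀ j, F j → ℝ≥0),
    (∀ i, Measurable (f i)) → (∀ j, Measurable (g j)) →
    Hyp E F c d B f g →
    (∏ i, (∫⁻ x, (f i x : ℝ≥0∞)) ^ c i) ≤
      ENNReal.ofReal (Real.exp D₀) * ∏ j, (∫⁻ y, (g j y : ℝ≥0∞)) ^ d j

/-- The best constant `D(c,d,B)` in the forward-reverse Brascamp-Lieb inequality. -/
def D : EReal :=
  sInf {x : EReal | ∃ D₀ : ℝ, x = (D₀ : EReal) ∧ IsBound E F c d B D₀}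

/-- The gaussian constraint `Λ_c B* U_d B Λ_c ≤ V_c`, written via quadratic forms. -/
def GaussCon (V : ∀ i, E i →ₗ[ℝ] E i) (U : ∀ j, F j →ₗ[ℝ] F j) : Prop :=
  ∀ x : ∀ i, E i,
    (∑ j, d j * ⟪U j (∑ i, c i • B i j (x i)), ∑ i, c i • B i j (x i)⟫) ≤
      ∑ i, c i * ⟪V i (x i), x i⟫

/-- The objective functional in the definition of the gaussian constant. -/
def gaussObj (V : ∀ i, E i →ₗ[ℝ] E i) (U : ∀ j, F j →ₗ[ℝ] F j) : ℝ :=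
  (∑ j, d j * Real.log (LinearMap.det (U j)) -
    ∑ i, c i * Real.log (LinearMap.det (V i))) / 2

/-- The gaussian best constant `D_g(c,d,B)`. -/
def Dg : EReal :=
  sSup {x : EReal | ∃ (V : ∀ i, E i →ₗ[ℝ] E i) (U : ∀ j, F j →ₗ[ℝ] F j),
    (∀ i, PosDef (V i)) ∧ (∀ j, PosDef (U j)) ∧ GaussCon E F c d B V U ∧
    x = (gaussObj E F c d V U : EReal)}

/-- The datum `(c,d,B)` is gaussian-extremizable: the supremum defining `D_g` is
finite and attained. -/
def GaussExt : Prop :=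
  ∃ (V : ∀ i, E i →ₗ[ℝ] E i) (U : ∀ j, F j →ₗ[ℝ] F j),
    (∀ i, PosDef (V i)) ∧ (∀ j, PosDef (U j)) ∧ GaussCon E F c d B V U ∧
    Dg E F c d B = (gaussObj E F c d V U : EReal)

/-- The canonical linear equivalence between `E₀ = ⊕ᵢ Eᵢ` (as `PiLp 2`) and the pi type. -/
def toPi : PiLp 2 E ≃ₗ[ℝ] ∀ i, E i := WithLp.linearEquiv 2 ℝ (∀ i, E i)

/-- Orthogonal projection `π_{E_i} : E₀ → E_i`. -/
def projL (i : Fin k) : PiLp 2 E →ₗ[ℝ] E i := (LinearMap.proj i).comp (toPi E).toLinearMap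

/-- The embedding `E_i → E₀`. -/
def singleL (i : Fin k) : E i →ₗ[ℝ] PiLp 2 E :=
  (toPi E).symm.toLinearMap.comp (LinearMap.single ℝ E i)

/-- The map `B_j : E₀ → E^j`, `x ↦ ∑ᵢ B_{ij} π_{E_i} x`. -/
def Bop (j : Fin m) : PiLp 2 E →ₗ[ℝ] F j := ∑ i, (B i j).comp (projL E i)

/-- `Λ_c = ⊕ᵢ cᵢ id_{E_i}` as an operator on `E₀`. -/
def Lam : PiLp 2 E →ₗ[ℝ] PiLp 2 E := ∑ i, c i • (singleL E i).comp (projL E i)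

/-- The set `Π(A_1, …, A_k)` of positive semidefinite "couplings". -/
def Coupling (A : ∀ i, E i →ₗ[ℝ] E i) : Set (PiLp 2 E →ₗ[ℝ] PiLp 2 E) :=
  {P | PosSemidef P ∧ ∀ (i : Fin k) (v : E i),
    ⟪P (singleL E i v), singleL E i v⟫ = ⟪A i v, v⟫}

/-- The scaling condition `∑ᵢ cᵢ dim Eᵢ = ∑ⱼ dⱼ dim E^j`. -/
def ScalingCond : Prop :=
  ∑ i, c i * (Module.finrank ℝ (E i) : ℝ) = ∑ j, d j * (Module.finrank ℝ (F j) : ℝ)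

/-- A subspace `T ⊆ E₀` is of product form, i.e. `T = ⊕ᵢ π_{E_i} T`. -/
def ProductForm (T : Submodule ℝ (PiLp 2 E)) : Prop :=
  ∀ x ∈ T, ∀ i, singleL E i (projL E i x) ∈ T

/-- The dimension condition over product-form subspaces. -/
def DimCond : Prop :=
  ∀ T : Submodule ℝ (PiLp 2 E), ProductForm E T →
    (∑ i, c i * (Module.finrank ℝ (T.map (projL E i)) : ℝ)) ≤
      ∑ j, d j * (Module.finrank ℝ (T.map (Bop E F B j)) : ℝ)

/-- A critical subspace. -/
def IsCritical (T : Submodule ℝ (PiLp 2 E)) : Prop :=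
  T ≠ ⊥ ∧ T ≠ ⊤ ∧ ProductForm E T ∧
    ∑ i, c i * (Module.finrank ℝ (T.map (projL E i)) : ℝ) =
      ∑ j, d j * (Module.finrank ℝ (T.map (Bop E F B j)) : ℝ)

/-- The datum is simple if it has no critical subspace. -/
def Simple : Prop := ∀ T : Submodule ℝ (PiLp 2 E), ¬ IsCritical E F c d B T

end FRBL

namespace FRBL

/-- `log det` with value `−∞` on operators with non-positive determinant
(in particular on singular positive-semidefinite operators). -/
def elogdet {G : Type*} [AddCommGroup G] [Module ℝ G] (A : G →ₗ[ℝ] G) : EReal :=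
  if 0 < LinearMap.det A then ((Real.log (LinearMap.det A) : ℝ) : EReal) else ⊥

variable {k m : ℕ}
  (E : Fin k → Type*) (F : Fin m → Type*)
  [∀ i, NormedAddCommGroup (E i)] [∀ i, InnerProductSpace ℝ (E i)]
  [∀ i, FiniteDimensional ℝ (E i)]
  [∀ j, NormedAddCommGroup (F j)] [∀ j, InnerProductSpace ℝ (F j)]
  [∀ j, FiniteDimensional ℝ (F j)]
  (c : Fin k → ℝ) (d : Fin m → ℝ)
  (B : ∀ i j, E i →ₗ[ℝ] F j)

/-- The map `Q_j := B_j Λ_c : E₀ → E^j`. -/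
def BLam (j : Fin m) : PiLp 2 E →ₗ[ℝ] F j := (Bop E F B j).comp (Lam E c)

/-- The optimality condition of Theorem 2 (structure of gaussian extremizers):
each `B_j Λ_c Π Λ_c B_j*` is invertible and
`∑ⱼ dⱼ Λ_c B_j* (B_j Λ_c Π Λ_c B_j*)⁻¹ B_j Λ_c ≤ V_c` in the quadratic-form sense. -/
def ExtCond (V : ∀ i, E i →ₗ[ℝ] E i) (P : PiLp 2 E →ₗ[ℝ] PiLp 2 E) : Prop :=
  (∀ j, IsUnit ((BLam E F c B j) ∘ₗ P ∘ₗ LinearMap.adjoint (BLam E F c B j))) ∧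
  ∀ x : PiLp 2 E,
    (∑ j, d j * ⟪Ring.inverse ((BLam E F c B j) ∘ₗ P ∘ₗ LinearMap.adjoint (BLam E F c B j))
        (BLam E F c B j x), BLam E F c B j x⟫) ≤
      ∑ i, c i * ⟪V i (projL E i x), projL E i x⟫

/-- A geometric datum. -/
def Geometric : Prop :=
  ScalingCond E F c d ∧
  ∃ S ∈ Coupling E (fun i => (LinearMap.id : E i →ₗ[ℝ] E i)),
    (∀ j, (BLam E F c B j) ∘ₗ S ∘ₗ LinearMap.adjoint (BLam E F c B j) = LinearMap.id) ∧
    ∀ x : PiLp 2 E, (∑ j, d j * ⟪BLam E F c B j x, BLam E F c B j x⟫) ≤ ⟪Lam E c x, x⟫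

/-- Equivalence of data: `B'_j = C_j⁻¹ B_j C⁻¹` for invertible `C, C_j`. -/
def EquivData (B' : ∀ i j, E i →ₗ[ℝ] F j) : Prop :=
  ∃ (C : PiLp 2 E ≃ₗ[ℝ] PiLp 2 E) (Cj : ∀ j, F j ≃ₗ[ℝ] F j),
    ∀ j, Bop E F B' j =
      ((Cj j).symm.toLinearMap ∘ₗ Bop E F B j) ∘ₗ C.symm.toLinearMap

/-- `V_c = ⊕ᵢ cᵢ Vᵢ` as an operator on `E₀`. -/
def blockDiag (V : ∀ i, E i →ₗ[ℝ] E i) : PiLp 2 E →ₗ[ℝ] PiLp 2 E :=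
  ∑ i, c i • ((singleL E i) ∘ₗ (V i)) ∘ₗ (projL E i)

/-- `Θ = V_c − ∑ⱼ dⱼ Λ_c B_j* U_j B_j Λ_c`. -/
def Theta (V : ∀ i, E i →ₗ[ℝ] E i) (U : ∀ j, F j →ₗ[ℝ] F j) :
    PiLp 2 E →ₗ[ℝ] PiLp 2 E :=
  blockDiag E c V -
    ∑ j, d j • (LinearMap.adjoint (BLam E F c B j) ∘ₗ (U j)) ∘ₗ (BLam E F c B j)

end FRBL

namespace FRBL

/-- Borel structure on submodules (inherited from the ambient space). -/
instance subBorel {G : Type*} [AddCommGroup G] [Module ℝ G] [TopologicalSpace G]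
    [MeasurableSpace G] [BorelSpace G] (T : Submodule ℝ G) : BorelSpace ↥T :=
  Subtype.borelSpace (T : Set G)

/-- The maximal dimension of a subspace on which the self-adjoint operator `Q` is positive
definite; by Sylvester's law of inertia this is the number of positive eigenvalues of `Q`,
counted with multiplicity. -/
def posIndex {H : Type*} [NormedAddCommGroup H] [InnerProductSpace ℝ H]
    (Q : H →ₗ[ℝ] H) : ℕ :=
  sSup {r : ℕ | ∃ W : Submodule ℝ H,
    (∀ x ∈ W, x ≠ 0 → 0 < ⟪Q x, x⟫) ∧ Module.finrank ℝ W = r}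

/-- The standard gaussian probability measure on a Euclidean space. -/
def stdGaussian (G : Type*) [NormedAddCommGroup G] [InnerProductSpace ℝ G]
    [FiniteDimensional ℝ G] [MeasurableSpace G] [BorelSpace G] :
    Measure G :=
  volume.withDensity fun x =>
    ENNReal.ofReal ((2 * Real.pi) ^ (-(Module.finrank ℝ G : ℝ) / 2) *
      Real.exp (-‖x‖ ^ 2 / 2))

/-- `K_s = (|s|^{1/s} |s'|^{1/s'})^{1/2}`. -/
def Kconst (s s' : ℝ) : ℝ := Real.sqrt (|s| ^ (1 / s) * |s'| ^ (1 / s'))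

variable {k m : ℕ}
  (E : Fin k → Type*) (F : Fin m → Type*)
  [∀ i, NormedAddCommGroup (E i)] [∀ i, InnerProductSpace ℝ (E i)]
  [∀ i, FiniteDimensional ℝ (E i)]
  [∀ j, NormedAddCommGroup (F j)] [∀ j, InnerProductSpace ℝ (F j)]
  [∀ j, FiniteDimensional ℝ (F j)]
  (c : Fin k → ℝ) (d : Fin m → ℝ)
  (B : ∀ i j, E i →ₗ[ℝ] F j)

/-- The objective functional `∑ⱼ dⱼ log det Uⱼ − ∑ᵢ cᵢ log det Vᵢ`. -/
def objective (V : ∀ i, E i →ₗ[ℝ] E i) (U : ∀ j, F j →ₗ[ℝ] F j) : ℝ :=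
  ∑ j, d j * Real.log (LinearMap.det (U j)) - ∑ i, c i * Real.log (LinearMap.det (V i))

/-- Feasibility for the optimization problem defining `D_g`: positive definiteness
together with the constraint `Θ ≥ 0`. -/
def Admissible (V : ∀ i, E i →ₗ[ℝ] E i) (U : ∀ j, F j →ₗ[ℝ] F j) : Prop :=
  (∀ i, PosDef (V i)) ∧ (∀ j, PosDef (U j)) ∧ PosSemidef (Theta E F c d B V U)

/-- Global maximality in the optimization problem defining `D_g`. -/
def IsGlobalMax (V : ∀ i, E i →ₗ[ℝ] E i) (U : ∀ j, F j →ₗ[ℝ] F j) : Prop :=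
  Admissible E F c d B V U ∧
    ∀ V' U', Admissible E F c d B V' U' →
      objective E F c d V' U' ≤ objective E F c d V U

/-- Local maximality in the optimization problem defining `D_g`. -/
def IsLocalMax (V : ∀ i, E i →ₗ[ℝ] E i) (U : ∀ j, F j →ₗ[ℝ] F j) : Prop :=
  Admissible E F c d B V U ∧
    ∃ ε : ℝ, 0 < ε ∧
      ∀ V' U', Admissible E F c d B V' U' →
        (∀ i, ‖LinearMap.toContinuousLinearMap (V' i - V i)‖ < ε) →
        (∀ j, ‖LinearMap.toContinuousLinearMap (U' j - U j)‖ < ε) →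
        objective E F c d V' U' ≤ objective E F c d V U

end FRBL

namespace FRBL

variable {k m : ℕ}
  (E : Fin k → Type*) (F : Fin m → Type*)
  [∀ i, NormedAddCommGroup (E i)] [∀ i, InnerProductSpace ℝ (E i)]
  [∀ i, FiniteDimensional ℝ (E i)]
  [∀ i, MeasurableSpace (E i)] [∀ i, BorelSpace (E i)]
  [∀ j, NormedAddCommGroup (F j)] [∀ j, InnerProductSpace ℝ (F j)]
  [∀ j, FiniteDimensional ℝ (F j)]
  [∀ j, MeasurableSpace (F j)] [∀ j, BorelSpace (F j)]



section SubspaceFubini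

variable {G : Type*} [NormedAddCommGroup G] [InnerProductSpace ℝ G] [FiniteDimensional ℝ G]
  [MeasurableSpace G] [BorelSpace G]

/-- The integral over the fibre through `x` parallel to the subspace `K`. -/
def fiberIntegral (K : Submodule ℝ G) (h : G → ℝ≥0) (x : G) : ℝ≥0∞ :=
  ∫⁻ y : K, (h (x + y) : ℝ≥0∞)

lemma fiberIntegral_add_mem (K : Submodule ℝ G) (h : G → ℝ≥0) (x : G) (w : K) :
    fiberIntegral K h (x + w) = fiberIntegral K h x := by
  have := lintegral_add_left_eq_self (μ := (volume : Measure K))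
    (fun y : K => (h (x + y) : ℝ≥0∞)) w
  simpa only [fiberIntegral, Submodule.coe_add, add_assoc] using this

lemma measurable_fiberIntegral (K : Submodule ℝ G) {h : G → ℝ≥0} (hh : Measurable h) :
    Measurable (fiberIntegral K h) := by
  unfold fiberIntegral
  apply Measurable.lintegral_prod_right' (f := fun p : G × K => (h (p.1 + p.2) : ℝ≥0∞))
  fun_prop

lemma lintegral_eq_lintegral_fiberIntegral (K : Submodule ℝ G) {h : G → ℝ≥0}
    (hh : Measurable h) :
    ∫⁻ x, (h x : ℝ≥0∞) = ∫⁻ x : Kᗮ, fiberIntegral K h x := by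
  have hmp := K.orthogonalDecomposition.symm.measurePreserving.comp
    (WithLp.volume_preserving_toLp (U := K) (V := Kᗮ))
  have hm : Measurable fun x : G => (h x : ℝ≥0∞) := by fun_prop
  rw [← hmp.lintegral_comp hm, Measure.volume_eq_prod]
  refine (lintegral_prod_symm _ (hm.comp hmp.measurable).aemeasurable).trans ?_
  refine lintegral_congr fun x => lintegral_congr fun y => ?_
  have hxy : K.orthogonalDecomposition.symm (WithLp.toLp 2 (y, x)) = (x : G) + y :=
    add_comm (y : G) x
  exact congrArg (fun z => (h z : ℝ≥0∞)) hxy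

lemma fiberIntegral_ne_top (K : Submodule ℝ G) {h : G → ℝ≥0} {C : ℝ≥0} {R : ℝ}
    (hC : ∀ x, h x ≤ C) (hR : ∀ x, R < ‖x‖ → h x = 0) (x : G) :
    fiberIntegral K h x ≠ ∞ := by
  have hle : fiberIntegral K h x ≤
      ∫⁻ y : K, (Metric.closedBall (0 : K) (R + ‖x‖)).indicator (fun _ => (C : ℝ≥0∞)) y := by
    refine lintegral_mono fun y => ?_
    by_cases hy : y ∈ Metric.closedBall (0 : K) (R + ‖x‖)
    · simpa [Set.indicator_of_mem hy] using hC _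
    · have h0 : h (x + y) = 0 := by
        apply hR
        have h1 : R + ‖x‖ < ‖(y : G)‖ := by simpa using hy
        have h2 : ‖(y : G)‖ ≤ ‖x + y‖ + ‖x‖ := by
          simpa using norm_sub_le (x + (y : G)) x
        linarith
      simp [h0]
  refine ne_top_of_le_ne_top ?_ hle
  rw [lintegral_indicator_const measurableSet_closedBall]
  exact ENNReal.mul_ne_top ENNReal.coe_ne_top measure_closedBall_lt_top.ne

end SubspaceFubini


section Bounds

lemma lintegral_coe_indicator_one {X : Type*} [MeasureSpace X] {A : Set X}
    (hA : MeasurableSet A) :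
    ∫⁻ x, ((A.indicator (1 : X → ℝ≥0) x : ℝ≥0) : ℝ≥0∞) = volume A := by
  rw [← lintegral_indicator_one hA]
  refine lintegral_congr fun x => ?_
  by_cases hx : x ∈ A <;> simp [hx]

variable (c : Fin k → ℝ) (d : Fin m → ℝ) (B : ∀ i j, E i →ₗ[ℝ] F j)

/-- The linear map `x ↦ ∑ᵢ cᵢ B_{ij} xᵢ`. -/
def weightedSum (j : Fin m) : (∀ i, E i) →ₗ[ℝ] F j :=
  ∑ i, c i • (B i j ∘ₗ LinearMap.proj i)

set_option linter.unusedSectionVars false in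
lemma weightedSum_apply (j : Fin m) (x : ∀ i, E i) :
    weightedSum E F c B j x = ∑ i, c i • B i j (x i) := by
  simp [weightedSum]

lemma exists_norm_weightedSum_le (r : ℝ) : ∃ R : ℝ, 0 < R ∧
    ∀ x : ∀ i, E i, (∀ i, ‖x i‖ ≤ r) → ∀ j, ‖∑ i, c i • B i j (x i)‖ ≤ R := by
  refine ⟨∑ j, ‖(weightedSum E F c B j).toContinuousLinearMap‖ * |r| + 1, by positivity,
    fun x hx j => ?_⟩
  have h1 : ‖x‖ ≤ |r| := (pi_norm_le_iff_of_nonneg (abs_nonneg r)).2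
    fun i => (hx i).trans (le_abs_self r)
  have h2 := (weightedSum E F c B j).toContinuousLinearMap.le_opNorm_of_le h1
  rw [LinearMap.coe_toContinuousLinearMap', weightedSum_apply] at h2
  have h3 := Finset.single_le_sum
    (f := fun j => ‖(weightedSum E F c B j).toContinuousLinearMap‖ * |r|)
    (fun j _ => by positivity) (Finset.mem_univ j)
  linarith

/-- The forward-reverse Brascamp-Lieb inequality with constant `D₀`, tested only on bounded
functions with bounded support. -/
def IsBoundOnBounded (D₀ : ℝ) : Prop :=
  ∀ (f : ∀ i, E i → ℝ≥0) (g : ∀ j, F j → ℝ≥0) (C : ℝ≥0) (R : ℝ),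
    (∀ i, Measurable (f i)) → (∀ j, Measurable (g j)) →
    (∀ i x, f i x ≤ C) → (∀ i x, R < ‖x‖ → f i x = 0) →
    (∀ j y, g j y ≤ C) → (∀ j y, R < ‖y‖ → g j y = 0) →
    Hyp E F c d B f g →
    (∏ i, (∫⁻ x, (f i x : ℝ≥0∞)) ^ c i) ≤
      ENNReal.ofReal (Real.exp D₀) * ∏ j, (∫⁻ y, (g j y : ℝ≥0∞)) ^ d j

variable {E F c d B}

lemma IsBound.isBoundOnBounded {D₀ : ℝ} (h : IsBound E F c d B D₀) :
    IsBoundOnBounded E F c d B D₀ :=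
  fun f g _ _ hf hg _ _ _ _ hyp => h f g hf hg hyp

/-- Testing the inequality on indicators of unit balls on the left and of bounded sets
containing all the weighted sums on the right. -/
lemma IsBoundOnBounded.ball_le (hc : ∀ i, 0 < c i) {D₀ : ℝ}
    (h : IsBoundOnBounded E F c d B D₀) {S : ∀ j, Set (F j)} (hS : ∀ j, MeasurableSet (S j))
    {R : ℝ} (hSR : ∀ j, ∀ y ∈ S j, ‖y‖ ≤ R)
    (hmem : ∀ x : ∀ i, E i, (∀ i, ‖x i‖ ≤ 1) → ∀ j, ∑ i, c i • B i j (x i) ∈ S j) :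
    (∏ i, volume (Metric.closedBall (0 : E i) 1) ^ c i) ≤
      ENNReal.ofReal (Real.exp D₀) * ∏ j, volume (S j) ^ d j := by
  have key := h (fun i => (Metric.closedBall (0 : E i) 1).indicator 1)
    (fun j => (S j).indicator 1) 1 (max 1 R)
    (fun i => measurable_one.indicator measurableSet_closedBall)
    (fun j => measurable_one.indicator (hS j))
    (fun i x => Set.indicator_le_self' (fun _ _ => zero_le_one) x)
    (fun i x hx => Set.indicator_of_notMem (by simpa using (le_max_left _ _).trans_lt hx) _)
    (fun j y => Set.indicator_le_self' (fun _ _ => zero_le_one) y)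
    (fun j y hy => Set.indicator_of_notMem
      (fun hy' => (hSR j y hy').not_gt ((le_max_right _ _).trans_lt hy)) _)
    (by
      intro x
      by_cases hx : ∀ i, ‖x i‖ ≤ 1
      · have h1 : ∀ i, (Metric.closedBall (0 : E i) 1).indicator (1 : E i → ℝ≥0) (x i) = 1 :=
          fun i => by simp [hx i]
        have h2 : ∀ j, (S j).indicator (1 : F j → ℝ≥0) (∑ i, c i • B i j (x i)) = 1 :=
          fun j => by simp [hmem x hx j]
        simp [h1, h2]
      · obtain ⟨i, hi⟩ := not_forall.1 hx
        have h1 : (Metric.closedBall (0 : E i) 1).indicator (1 : E i → ℝ≥0) (x i) = 0 :=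
          Set.indicator_of_notMem (by simpa using hi) _
        exact (Finset.prod_eq_zero (Finset.mem_univ i)
          (by simp only [h1, NNReal.zero_rpow (hc i).ne'])).trans_le zero_le)
  simpa only [lintegral_coe_indicator_one measurableSet_closedBall,
    lintegral_coe_indicator_one (hS _)] using key

lemma prod_volume_closedBall_pos (hc : ∀ i, 0 < c i) :
    0 < ∏ i, volume (Metric.closedBall (0 : E i) 1) ^ c i := by
  refine pos_iff_ne_zero.2 (Finset.prod_ne_zero_iff.2 fun i _ => ?_)
  have := Metric.measure_closedBall_pos volume (0 : E i) one_pos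
  simp [ENNReal.rpow_eq_zero_iff, this.ne', (hc i).not_gt]

/-- A finite bound forces the maps `x ↦ ∑ᵢ cᵢ B_{ij} xᵢ` to be onto. -/
lemma IsBoundOnBounded.surjective (hc : ∀ i, 0 < c i) (hd : ∀ j, 0 < d j) {D₀ : ℝ}
    (h : IsBoundOnBounded E F c d B D₀) (j : Fin m) :
    Function.Surjective (weightedSum E F c B j) := by
  rw [← LinearMap.range_eq_top]
  by_contra hW
  obtain ⟨R, -, hR⟩ := exists_norm_weightedSum_le E F c B 1
  have key := h.ball_le hc
    (S := fun l => Metric.closedBall 0 R ∩ LinearMap.range (weightedSum E F c B l))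
    (fun l => measurableSet_closedBall.inter (Submodule.closed_of_finiteDimensional _).measurableSet)
    (R := R) (fun l y hy => by simpa using hy.1)
    (fun x hx l => ⟨by simpa using hR x hx l, x, weightedSum_apply E F c B l x⟩)
  have h0 : volume (Metric.closedBall 0 R ∩
      (LinearMap.range (weightedSum E F c B j) : Set (F j))) = 0 :=
    measure_mono_null Set.inter_subset_right (Measure.addHaar_submodule _ _ hW)
  rw [Finset.prod_eq_zero (Finset.mem_univ j) (by rw [h0, ENNReal.zero_rpow_of_pos (hd j)]),
    mul_zero] at key
  exact (prod_volume_closedBall_pos hc).not_ge key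

lemma D_ne_bot (hc : ∀ i, 0 < c i) (hd : ∀ j, 0 < d j) : D E F c d B ≠ ⊥ := by
  obtain ⟨R, -, hR⟩ := exists_norm_weightedSum_le E F c B 1
  set P := ∏ i, volume (Metric.closedBall (0 : E i) 1) ^ c i with hP
  set Q := ∏ j, volume (Metric.closedBall (0 : F j) R) ^ d j with hQ
  have hPpos : 0 < P := prod_volume_closedBall_pos hc
  have hPtop : P ≠ ∞ := ENNReal.prod_ne_top fun i _ =>
    ENNReal.rpow_ne_top_of_nonneg (hc i).le measure_closedBall_lt_top.ne
  have hQtop : Q ≠ ∞ := ENNReal.prod_ne_top fun i _ =>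
    ENNReal.rpow_ne_top_of_nonneg (hd i).le measure_closedBall_lt_top.ne
  have hbound : ∀ D₀ : ℝ, IsBound E F c d B D₀ → Real.log (P.toReal / Q.toReal) ≤ D₀ := by
    intro D₀ hD
    have key := hD.isBoundOnBounded.ball_le hc
      (S := fun j => Metric.closedBall 0 R) (fun j => measurableSet_closedBall)
      (R := R) (fun j y hy => by simpa using hy) (fun x hx j => by simpa using hR x hx j)
    have key' := ENNReal.toReal_mono (ENNReal.mul_ne_top ENNReal.ofReal_ne_top hQtop) key
    rw [ENNReal.toReal_mul, ENNReal.toReal_ofReal (Real.exp_pos _).le] at key'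
    have hPr : 0 < P.toReal := ENNReal.toReal_pos hPpos.ne' hPtop
    have hQr : 0 < Q.toReal := by
      by_contra hcon
      have : Q.toReal = 0 := le_antisymm (not_lt.1 hcon) ENNReal.toReal_nonneg
      rw [this, mul_zero] at key'
      exact hPr.not_ge key'
    rw [Real.log_le_iff_le_exp (by positivity), div_le_iff₀ hQr]
    exact key'
  have : ((Real.log (P.toReal / Q.toReal) : ℝ) : EReal) ≤ D E F c d B := by
    refine le_sInf ?_
    rintro _ ⟨D₀, rfl, hD⟩
    exact_mod_cast hbound D₀ hD
  exact ne_bot_of_le_ne_bot (EReal.coe_ne_bot _) this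

end Bounds

section Truncation

lemma tendsto_finsetProd_of_ne_zero {ι α : Type*} {l : Filter α} {u : ι → α → ℝ≥0∞}
    {a : ι → ℝ≥0∞} (s : Finset ι) (h : ∀ i ∈ s, Filter.Tendsto (u i) l (nhds (a i)))
    (ha : ∀ i ∈ s, a i ≠ 0) :
    Filter.Tendsto (fun x => ∏ i ∈ s, u i x) l (nhds (∏ i ∈ s, a i)) := by
  classical
  induction s using Finset.induction_on with
  | empty => simpa using tendsto_const_nhds
  | insert i s hi ih =>
    simp only [Finset.prod_insert hi]
    rw [Finset.forall_mem_insert] at h ha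
    exact ENNReal.Tendsto.mul h.1 (Or.inl ha.1) (ih h.2 ha.2)
      (Or.inl (Finset.prod_ne_zero_iff.2 ha.2))

variable {c : Fin k → ℝ} {d : Fin m → ℝ} {B : ∀ i j, E i →ₗ[ℝ] F j}
variable {E F}

/-- If some `g j` vanishes almost everywhere and the maps `x ↦ ∑ᵢ cᵢ B_{ij} xᵢ` are onto, then
domination forces some `f i` to vanish almost everywhere. -/
lemma Hyp.prod_lintegral_eq_zero (hc : ∀ i, 0 < c i) (hd : ∀ j, 0 < d j)
    {f : ∀ i, E i → ℝ≥0} {g : ∀ j, F j → ℝ≥0}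
    (hf : ∀ i, Measurable (f i)) (hg : ∀ j, Measurable (g j)) (hyp : Hyp E F c d B f g)
    {j : Fin m} (hsurj : Function.Surjective (weightedSum E F c B j))
    (hj : ∫⁻ y, (g j y : ℝ≥0∞) = 0) :
    ∏ i, (∫⁻ x, (f i x : ℝ≥0∞)) ^ c i = 0 := by
  have hgj : ∀ᵐ y : F j, y ∈ {y | g j y = 0} := by
    have := (lintegral_eq_zero_iff (by fun_prop)).1 hj
    filter_upwards [this] with y hy
    simpa using hy
  have hcomp := (ae_comp_linearMap_mem_iff (weightedSum E F c B j)
    (volume : Measure (∀ i, E i)) (volume : Measure (F j)) hsurj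
    (measurableSet_eq_fun (hg j) measurable_const)).2 hgj
  have hnull : volume (Set.univ.pi fun i => {x | f i x ≠ 0}) = 0 := by
    refine measure_mono_null ?_ (ae_iff.1 hcomp)
    intro x hx hx0
    have h0 : g j (∑ i, c i • B i j (x i)) = 0 := by
      rw [← weightedSum_apply]
      exact hx0
    have h1 := hyp x
    rw [Finset.prod_eq_zero (Finset.mem_univ j) (by rw [h0, NNReal.zero_rpow (hd j).ne'])] at h1
    obtain ⟨i, -, hi⟩ := Finset.prod_eq_zero_iff.1 (le_antisymm h1 zero_le)
    exact hx i (Set.mem_univ i) ((NNReal.rpow_eq_zero (hc i).ne').1 hi)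
  rw [volume_pi_pi] at hnull
  obtain ⟨i, -, hi⟩ := Finset.prod_eq_zero_iff.1 hnull
  refine Finset.prod_eq_zero (Finset.mem_univ i) ?_
  rw [ENNReal.rpow_eq_zero_iff_of_pos (hc i), lintegral_eq_zero_iff (by have := hf i; fun_prop)]
  refine (ae_iff.2 hi).mono fun x hx => ?_
  simpa using hx

/-- Truncation of the functions `g j` to bounded ones. -/
lemma IsBoundOnBounded.le_of_bounded_left (hc : ∀ i, 0 < c i) (hd : ∀ j, 0 < d j) {D₀ : ℝ}
    (h : IsBoundOnBounded E F c d B D₀) {f : ∀ i, E i → ℝ≥0} {g : ∀ j, F j → ℝ≥0}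
    {C : ℝ≥0} {R : ℝ} (hf : ∀ i, Measurable (f i)) (hg : ∀ j, Measurable (g j))
    (hfC : ∀ i x, f i x ≤ C) (hfR : ∀ i x, R < ‖x‖ → f i x = 0)
    (hgfin : ∀ j, ∫⁻ y, (g j y : ℝ≥0∞) ≠ ∞) (hyp : Hyp E F c d B f g) :
    (∏ i, (∫⁻ x, (f i x : ℝ≥0∞)) ^ c i) ≤
      ENNReal.ofReal (Real.exp D₀) * ∏ j, (∫⁻ y, (g j y : ℝ≥0∞)) ^ d j := by
  obtain ⟨S, -, hS⟩ := exists_norm_weightedSum_le E F c B R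
  set v : Fin m → ℝ≥0∞ := fun j => volume (Metric.closedBall (0 : F j) S) with hv
  have hvtop : ∀ j, v j ≠ ∞ := fun j => measure_closedBall_lt_top.ne
  have step : ∀ ε : ℝ≥0, 0 < ε → (∏ i, (∫⁻ x, (f i x : ℝ≥0∞)) ^ c i) ≤
      ENNReal.ofReal (Real.exp D₀) * ∏ j, ((∫⁻ y, (g j y : ℝ≥0∞)) + ε * v j) ^ d j := by
    intro ε hε
    obtain ⟨M, hM, hMε⟩ : ∃ M : ℝ≥0, (∀ j, (∏ i, C ^ c i) /
        (∏ l ∈ Finset.univ.erase j, ε ^ d l) ≤ M ^ d j) ∧ ε ≤ M := by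
      have h1 : ∀ j, ∀ᶠ t : ℝ≥0 in Filter.atTop, (∏ i, C ^ c i) /
          (∏ l ∈ Finset.univ.erase j, ε ^ d l) ≤ t ^ d j := fun j =>
        (NNReal.tendsto_rpow_atTop (hd j)).eventually_ge_atTop _
      exact ((Filter.eventually_all.2 h1).and (Filter.eventually_ge_atTop ε)).exists
    set g' : ∀ j, F j → ℝ≥0 := fun j =>
      (Metric.closedBall (0 : F j) S).indicator fun y => min (max (g j y) ε) M with hg'
    have key := h f g' (max C M) (max R S) hf
      (fun j => (((hg j).max measurable_const).min measurable_const).indicator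
        measurableSet_closedBall)
      (fun i x => (hfC i x).trans (le_max_left _ _))
      (fun i x hx => hfR i x ((le_max_left _ _).trans_lt hx))
      (fun j y => by
        refine (Set.indicator_le_self' (fun _ _ => zero_le) y).trans ?_
        exact (min_le_right _ _).trans (le_max_right _ _))
      (fun j y hy => Set.indicator_of_notMem
        (by simpa using (le_max_right _ _).trans_lt hy) _)
      (by
        intro x
        by_cases hx : ∀ i, ‖x i‖ ≤ R
        · have hmem : ∀ j, g' j (∑ i, c i • B i j (x i)) =
              min (max (g j (∑ i, c i • B i j (x i))) ε) M := fun j =>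
            Set.indicator_of_mem (by simpa using hS x hx j) _
          simp only [hmem]
          by_cases hle : ∀ j, g j (∑ i, c i • B i j (x i)) ≤ M
          · refine (hyp x).trans (Finset.prod_le_prod' fun j _ => ?_)
            exact NNReal.rpow_le_rpow (le_min (le_max_left _ _) (hle j)) (hd j).le
          · obtain ⟨j, hj⟩ := not_forall.1 hle
            rw [not_le] at hj
            have hpos : 0 < ∏ l ∈ Finset.univ.erase j, ε ^ d l :=
              Finset.prod_pos fun l _ => NNReal.rpow_pos hε
            calc ∏ i, f i (x i) ^ c i ≤ ∏ i, C ^ c i :=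
                  Finset.prod_le_prod' fun i _ => NNReal.rpow_le_rpow (hfC i _) (hc i).le
              _ ≤ M ^ d j * ∏ l ∈ Finset.univ.erase j, ε ^ d l :=
                  (div_le_iff₀ hpos).1 (hM j)
              _ ≤ min (max (g j (∑ i, c i • B i j (x i))) ε) M ^ d j *
                  ∏ l ∈ Finset.univ.erase j,
                    min (max (g l (∑ i, c i • B i l (x i))) ε) M ^ d l := by
                  gcongr with l hl
                  · exact (hd j).le
                  · exact le_min (hj.le.trans (le_max_left _ _)) le_rfl
                  · exact (hd l).le
                  · exact le_min (le_max_right _ _) hMε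
              _ = _ := Finset.mul_prod_erase _
                  (fun l => min (max (g l (∑ i, c i • B i l (x i))) ε) M ^ d l)
                  (Finset.mem_univ j)
        · obtain ⟨i, hi⟩ := not_forall.1 hx
          exact (Finset.prod_eq_zero (Finset.mem_univ i)
            (by rw [hfR i _ (not_le.1 hi), NNReal.zero_rpow (hc i).ne'])).trans_le zero_le)
    refine key.trans ?_
    gcongr with j
    · exact (hd j).le
    · calc ∫⁻ y, (g' j y : ℝ≥0∞) ≤ ∫⁻ y, ((g j y : ℝ≥0∞) +
            (Metric.closedBall (0 : F j) S).indicator (fun _ => (ε : ℝ≥0∞)) y) := by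
            refine lintegral_mono fun y => ?_
            by_cases hy : y ∈ Metric.closedBall (0 : F j) S
            · simp only [hg', Set.indicator_of_mem hy]
              exact_mod_cast (min_le_left _ _).trans
                (max_le (le_add_of_nonneg_right zero_le) (le_add_of_nonneg_left zero_le))
            · simp [hg', Set.indicator_of_notMem hy]
        _ = _ := by
            rw [lintegral_add_left (by have := hg j; fun_prop),
              lintegral_indicator_const measurableSet_closedBall]
  have hlim : Filter.Tendsto (fun ε : ℝ≥0 => ENNReal.ofReal (Real.exp D₀) *
      ∏ j, ((∫⁻ y, (g j y : ℝ≥0∞)) + ε * v j) ^ d j) (nhdsWithin 0 (Set.Ioi 0))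
      (nhds (ENNReal.ofReal (Real.exp D₀) * ∏ j, (∫⁻ y, (g j y : ℝ≥0∞)) ^ d j)) := by
    refine ENNReal.Tendsto.const_mul ?_ (Or.inr ENNReal.ofReal_ne_top)
    refine ENNReal.tendsto_finsetProd_of_ne_top _ (fun j _ => ?_)
      (fun j _ => ENNReal.rpow_ne_top_of_nonneg (hd j).le (hgfin j))
    refine ((ENNReal.continuous_rpow_const (y := d j)).tendsto _).comp ?_
    have h1 : Filter.Tendsto (fun ε : ℝ≥0 => (ε : ℝ≥0∞) * v j) (nhdsWithin 0 (Set.Ioi 0))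
        (nhds (((0 : ℝ≥0) : ℝ≥0∞) * v j)) :=
      ENNReal.Tendsto.mul_const
        (ENNReal.tendsto_coe.2 (Filter.tendsto_id.mono_left nhdsWithin_le_nhds))
        (Or.inr (hvtop j))
    simpa using tendsto_const_nhds.add h1
  exact ge_of_tendsto hlim (eventually_nhdsWithin_of_forall fun ε hε => step ε hε)

/-- It suffices to test the forward-reverse Brascamp-Lieb inequality on bounded functions with
bounded support. -/
lemma IsBoundOnBounded.isBound (hc : ∀ i, 0 < c i) (hd : ∀ j, 0 < d j) {D₀ : ℝ}
    (h : IsBoundOnBounded E F c d B D₀) : IsBound E F c d B D₀ := by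
  intro f g hf hg hyp
  by_cases hf0 : ∃ i, ∫⁻ x, (f i x : ℝ≥0∞) = 0
  · obtain ⟨i, hi⟩ := hf0
    exact (Finset.prod_eq_zero (Finset.mem_univ i)
      (by rw [hi, ENNReal.zero_rpow_of_pos (hc i)])).trans_le zero_le
  by_cases hg0 : ∃ j, ∫⁻ y, (g j y : ℝ≥0∞) = 0
  · obtain ⟨j, hj⟩ := hg0
    exact (hyp.prod_lintegral_eq_zero hc hd hf hg (h.surjective hc hd j) hj).trans_le zero_le
  push Not at hf0 hg0
  by_cases hgtop : ∃ j, ∫⁻ y, (g j y : ℝ≥0∞) = ∞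
  · obtain ⟨j, hj⟩ := hgtop
    have htop : ∏ j, (∫⁻ y, (g j y : ℝ≥0∞)) ^ d j = ∞ := by
      rw [← Finset.mul_prod_erase _ _ (Finset.mem_univ j), hj, ENNReal.top_rpow_of_pos (hd j)]
      refine ENNReal.top_mul (Finset.prod_ne_zero_iff.2 fun l _ => ?_)
      rw [Ne, ENNReal.rpow_eq_zero_iff_of_pos (hd l)]
      exact hg0 l
    rw [htop, ENNReal.mul_top (by simp [Real.exp_pos])]
    exact le_top
  push Not at hgtop
  set fn : ℕ → ∀ i, E i → ℝ≥0 := fun n i =>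
    (Metric.closedBall (0 : E i) n).indicator fun x => min (f i x) n with hfn
  have hfn_meas : ∀ n i, Measurable (fn n i) := fun n i =>
    ((hf i).min measurable_const).indicator measurableSet_closedBall
  have hfn_le : ∀ n i x, fn n i x ≤ f i x := fun n i x =>
    (Set.indicator_le_self' (fun _ _ => zero_le) x).trans (min_le_left _ _)
  have hlim : Filter.Tendsto (fun n => ∏ i, (∫⁻ x, (fn n i x : ℝ≥0∞)) ^ c i) Filter.atTop
      (nhds (∏ i, (∫⁻ x, (f i x : ℝ≥0∞)) ^ c i)) := by
    refine tendsto_finsetProd_of_ne_zero _ (fun i _ => ?_) (fun i _ => ?_)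
    · refine ((ENNReal.continuous_rpow_const (y := c i)).tendsto _).comp ?_
      refine lintegral_tendsto_of_tendsto_of_monotone
        (fun n => by have := hfn_meas n i; fun_prop) (ae_of_all _ fun x a b hab => ?_)
        (ae_of_all _ fun x => ?_)
      · rw [ENNReal.coe_le_coe]
        have hab' : (a : ℝ) ≤ b := by exact_mod_cast hab
        by_cases hx : x ∈ Metric.closedBall (0 : E i) a
        · simp only [hfn, Set.indicator_of_mem hx,
            Set.indicator_of_mem (Metric.closedBall_subset_closedBall hab' hx)]
          exact min_le_min le_rfl (by exact_mod_cast hab)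
        · simp [hfn, Set.indicator_of_notMem hx]
      · refine tendsto_const_nhds.congr' ?_
        obtain ⟨N₁, hN₁⟩ := exists_nat_ge ‖x‖
        obtain ⟨N₂, hN₂⟩ := exists_nat_ge (f i x)
        filter_upwards [Filter.eventually_ge_atTop N₁, Filter.eventually_ge_atTop N₂]
          with n h1 h2
        have hx : x ∈ Metric.closedBall (0 : E i) n := by
          simpa using hN₁.trans (by exact_mod_cast h1)
        have h3 : f i x ≤ n := hN₂.trans (by exact_mod_cast h2)
        simp only [hfn, Set.indicator_of_mem hx, min_eq_left h3]
    · rw [Ne, ENNReal.rpow_eq_zero_iff_of_pos (hc i)]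
      exact hf0 i
  refine le_of_tendsto' hlim fun n => ?_
  refine h.le_of_bounded_left hc hd (C := n) (R := n) (hfn_meas n) hg (fun i x => ?_)
    (fun i x hx => ?_) hgtop (fun x => ?_)
  · exact (Set.indicator_le_self' (fun _ _ => zero_le) x).trans (min_le_right _ _)
  · exact Set.indicator_of_notMem (by simpa using hx) _
  · exact (Finset.prod_le_prod' fun i _ =>
      NNReal.rpow_le_rpow (hfn_le n i _) (hc i).le).trans (hyp x)

end Truncation

section Decomposition

variable {c : Fin k → ℝ} {d : Fin m → ℝ} {B : ∀ i j, E i →ₗ[ℝ] F j}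
variable {E F}

lemma exists_prod_rpow_eq {ι : Type*} [Fintype ι] [Nonempty ι] {p : ι → ℝ}
    (hp : ∀ i, 0 < p i) {t : ℝ≥0} (ht : t ≠ 0) : ∃ a : ℝ≥0, ∏ i, a ^ p i = t := by
  have hsum : 0 < ∑ i, p i := Finset.sum_pos (fun i _ => hp i) Finset.univ_nonempty
  refine ⟨t ^ (∑ i, p i)⁻¹, NNReal.eq ?_⟩
  have ht' : (0 : ℝ) < t := NNReal.coe_pos.2 (pos_iff_ne_zero.2 ht)
  push_cast
  rw [← Real.rpow_sum_of_pos (by positivity), ← Real.rpow_mul ht'.le, inv_mul_cancel₀ hsum.ne',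
    Real.rpow_one]

lemma prod_lintegral_const_mul {ι : Type*} [Fintype ι] {X : ι → Type*} [∀ i, MeasureSpace (X i)]
    {p : ι → ℝ} (hp : ∀ i, 0 < p i) {f : ∀ i, X i → ℝ≥0} (hf : ∀ i, Measurable (f i))
    (a : ℝ≥0) :
    ∏ i, (∫⁻ x, ((a * f i x : ℝ≥0) : ℝ≥0∞)) ^ p i =
      ((∏ i, a ^ p i : ℝ≥0) : ℝ≥0∞) * ∏ i, (∫⁻ x, (f i x : ℝ≥0∞)) ^ p i := by
  push_cast
  rw [← Finset.prod_mul_distrib]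
  refine Finset.prod_congr rfl fun i _ => ?_
  rw [lintegral_const_mul _ (by have := hf i; fun_prop), ENNReal.mul_rpow_of_nonneg _ _ (hp i).le,
    ENNReal.coe_rpow_of_nonneg _ (hp i).le]

/-- Homogeneity of the forward-reverse Brascamp-Lieb inequality. -/
lemma IsBound.le_of_le_mul (hc : ∀ i, 0 < c i) (hd : ∀ j, 0 < d j) {D₀ : ℝ}
    (h : IsBound E F c d B D₀) {f : ∀ i, E i → ℝ≥0} {g : ∀ j, F j → ℝ≥0}
    (hf : ∀ i, Measurable (f i)) (hg : ∀ j, Measurable (g j)) {t : ℝ≥0} (ht : t ≠ 0)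
    (hyp : ∀ x : ∀ i, E i,
      (∏ i, f i (x i) ^ c i) ≤ t * ∏ j, g j (∑ i, c i • B i j (x i)) ^ d j) :
    (∏ i, (∫⁻ x, (f i x : ℝ≥0∞)) ^ c i) ≤
      ENNReal.ofReal (Real.exp D₀) * (t * ∏ j, (∫⁻ y, (g j y : ℝ≥0∞)) ^ d j) := by
  rcases isEmpty_or_nonempty (Fin m) with hm | hm
  · rcases isEmpty_or_nonempty (Fin k) with hk | hk
    · have h1 := h f g hf hg (fun x => by simp)
      have h2 : (1 : ℝ≥0∞) ≤ t := by simpa using hyp (fun i => hk.elim i)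
      simp only [Finset.univ_eq_empty, Finset.prod_empty, mul_one] at h1 ⊢
      exact h1.trans (le_mul_of_one_le_right zero_le h2)
    · obtain ⟨a, ha⟩ := exists_prod_rpow_eq hc (inv_ne_zero ht)
      have h1 := h (fun i x => a * f i x) g (fun i => (hf i).const_mul a) hg (fun x => by
        simp only [NNReal.mul_rpow, Finset.prod_mul_distrib, ha]
        exact (inv_mul_le_iff₀ (pos_iff_ne_zero.2 ht)).2 (hyp x))
      rw [prod_lintegral_const_mul hc hf, ha] at h1
      calc _ = (t : ℝ≥0∞) * (((t⁻¹ : ℝ≥0) : ℝ≥0∞) * ∏ i, (∫⁻ x, (f i x : ℝ≥0∞)) ^ c i) := by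
            rw [← mul_assoc, ← ENNReal.coe_mul, mul_inv_cancel₀ ht, ENNReal.coe_one, one_mul]
        _ ≤ t * (ENNReal.ofReal (Real.exp D₀) * ∏ j, (∫⁻ y, (g j y : ℝ≥0∞)) ^ d j) := by
            gcongr
        _ = _ := mul_left_comm _ _ _
  · obtain ⟨a, ha⟩ := exists_prod_rpow_eq hd ht
    have h1 := h f (fun j y => a * g j y) hf (fun j => (hg j).const_mul a) (fun x => by
      simp only [NNReal.mul_rpow, Finset.prod_mul_distrib, ha]
      exact hyp x)
    rwa [prod_lintegral_const_mul hd hg, ha] at h1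

variable {P : ∀ i, Submodule ℝ (E i)} {Q : ∀ j, Submodule ℝ (F j)}
  {BT : ∀ i j, P i →ₗ[ℝ] Q j} {BQ : ∀ i j, (P i)ᗮ →ₗ[ℝ] (Q j)ᗮ}

/-- The forward-reverse Brascamp-Lieb inequality on the fibres of a decomposition. -/
lemma IsBound.prod_fiberIntegral_le
    (hBT : ∀ i j (x : P i), (BT i j x : F j) = B i j (x : E i))
    (hBQ : ∀ i j (x : (P i)ᗮ), B i j (x : E i) - (BQ i j x : F j) ∈ Q j)
    {D₁ : ℝ} (h₁ : IsBound (fun i => P i) (fun j => Q j) c d BT D₁)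
    {f : ∀ i, E i → ℝ≥0} {g : ∀ j, F j → ℝ≥0}
    (hf : ∀ i, Measurable (f i)) (hg : ∀ j, Measurable (g j)) (hyp : Hyp E F c d B f g)
    (x : ∀ i, (P i)ᗮ) :
    ∏ i, fiberIntegral (P i) (f i) (x i) ^ c i ≤ ENNReal.ofReal (Real.exp D₁) *
      ∏ j, fiberIntegral (Q j) (g j) (∑ i, c i • BQ i j (x i) : (Q j)ᗮ) ^ d j := by
  have hp : ∀ j, ∑ i, c i • B i j (x i) - ((∑ i, c i • BQ i j (x i) : (Q j)ᗮ) : F j) ∈ Q j := by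
    intro j
    push_cast
    rw [← Finset.sum_sub_distrib]
    refine Submodule.sum_mem _ fun i _ => ?_
    rw [← smul_sub]
    exact Submodule.smul_mem _ _ (hBQ i j (x i))
  have hfib : ∀ j, fiberIntegral (Q j) (g j) (∑ i, c i • BQ i j (x i) : (Q j)ᗮ) =
      fiberIntegral (Q j) (g j) (∑ i, c i • B i j (x i)) := by
    intro j
    rw [← fiberIntegral_add_mem (Q j) (g j) _ ⟨_, hp j⟩]
    simp
  simp only [hfib]
  refine h₁ (fun i y => f i (x i + y)) (fun j z => g j (∑ i, c i • B i j (x i) + z))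
    (fun i => by have := hf i; fun_prop) (fun j => by have := hg j; fun_prop) fun y => ?_
  have hsum : ∀ j, ∑ i, c i • B i j (x i + y i) =
      ∑ i, c i • B i j (x i) + ((∑ i, c i • BT i j (y i) : Q j) : F j) := by
    intro j
    push_cast
    simp only [hBT, map_add, smul_add, Finset.sum_add_distrib]
  simpa only [hsum] using hyp fun i => x i + y i

lemma IsBound.add_of_decomposition (hc : ∀ i, 0 < c i) (hd : ∀ j, 0 < d j)
    (hBT : ∀ i j (x : P i), (BT i j x : F j) = B i j (x : E i))
    (hBQ : ∀ i j (x : (P i)ᗮ), B i j (x : E i) - (BQ i j x : F j) ∈ Q j)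
    {D₁ D₂ : ℝ} (h₁ : IsBound (fun i => P i) (fun j => Q j) c d BT D₁)
    (h₂ : IsBound (fun i => (P i)ᗮ) (fun j => (Q j)ᗮ) c d BQ D₂) :
    IsBound E F c d B (D₁ + D₂) := by
  refine IsBoundOnBounded.isBound hc hd fun f g C R hf hg hfC hfR hgC hgR hyp => ?_
  have hcf : ∀ i x, (((fiberIntegral (P i) (f i) x).toNNReal : ℝ≥0) : ℝ≥0∞) =
      fiberIntegral (P i) (f i) x := fun i x =>
    ENNReal.coe_toNNReal (fiberIntegral_ne_top _ (hfC i) (hfR i) x)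
  have hcg : ∀ j y, (((fiberIntegral (Q j) (g j) y).toNNReal : ℝ≥0) : ℝ≥0∞) =
      fiberIntegral (Q j) (g j) y := fun j y =>
    ENNReal.coe_toNNReal (fiberIntegral_ne_top _ (hgC j) (hgR j) y)
  have hexp : ENNReal.ofReal (Real.exp D₁) = ((Real.exp D₁).toNNReal : ℝ≥0) := rfl
  have key := h₂.le_of_le_mul hc hd
    (f := fun i x => (fiberIntegral (P i) (f i) x).toNNReal)
    (g := fun j y => (fiberIntegral (Q j) (g j) y).toNNReal)
    (fun i => ((measurable_fiberIntegral _ (hf i)).comp measurable_subtype_coe).ennreal_toNNReal)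
    (fun j => ((measurable_fiberIntegral _ (hg j)).comp measurable_subtype_coe).ennreal_toNNReal)
    (t := (Real.exp D₁).toNNReal) (by simp [Real.exp_pos])
    (fun x => by
      rw [← ENNReal.coe_le_coe]
      push_cast
      simp only [ENNReal.coe_rpow_of_nonneg _ (hc _).le, ENNReal.coe_rpow_of_nonneg _ (hd _).le,
        hcf, hcg]
      have := h₁.prod_fiberIntegral_le hBT hBQ hf hg hyp x
      push_cast at this
      exact this)
  simp only [hcf, hcg, ← lintegral_eq_lintegral_fiberIntegral _ (hf _),
    ← lintegral_eq_lintegral_fiberIntegral _ (hg _)] at key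
  rw [← hexp, ← mul_assoc, ← ENNReal.ofReal_mul (Real.exp_pos _).le, ← Real.exp_add,
    add_comm D₂] at key
  exact key

lemma D_le_add (hc : ∀ i, 0 < c i) (hd : ∀ j, 0 < d j)
    (hBT : ∀ i j (x : P i), (BT i j x : F j) = B i j (x : E i))
    (hBQ : ∀ i j (x : (P i)ᗮ), B i j (x : E i) - (BQ i j x : F j) ∈ Q j) :
    D E F c d B ≤ D (fun i => P i) (fun j => Q j) c d BT +
      D (fun i => (P i)ᗮ) (fun j => (Q j)ᗮ) c d BQ := by
  refine EReal.le_add_of_forall_gt (Or.inl (D_ne_bot hc hd)) (Or.inr (D_ne_bot hc hd))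
    fun a ha b hb => ?_
  obtain ⟨_, ⟨D₁, rfl, h₁⟩, ha⟩ := sInf_lt_iff.1 ha
  obtain ⟨_, ⟨D₂, rfl, h₂⟩, hb⟩ := sInf_lt_iff.1 hb
  refine le_trans (sInf_le ⟨D₁ + D₂, EReal.coe_add D₁ D₂, ?_⟩) (add_le_add ha.le hb.le)
  exact h₁.add_of_decomposition hc hd hBT hBQ h₂

end Decomposition

section SchurComplement

variable {G : Type*} [NormedAddCommGroup G] [InnerProductSpace ℝ G]

lemma PosDef.injective {V : G →ₗ[ℝ] G} (hV : PosDef V) : Function.Injective V := by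
  refine (injective_iff_map_eq_zero V).2 fun x hx => ?_
  by_contra h
  simpa [hx] using hV.2 x h

lemma PosDef.inner_self_nonneg {V : G →ₗ[ℝ] G} (hV : PosDef V) (x : G) : 0 ≤ ⟪V x, x⟫ := by
  rcases eq_or_ne x 0 with rfl | hx
  · simp
  · exact (hV.2 x hx).le

variable [FiniteDimensional ℝ G]

lemma PosDef.det_ne_zero {V : G →ₗ[ℝ] G} (hV : PosDef V) : LinearMap.det V ≠ 0 :=
  (LinearEquiv.isUnit_det' (LinearEquiv.ofInjectiveEndo V hV.injective)).ne_zero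

/-- The compression of an operator to a subspace. -/
def compression (K : Submodule ℝ G) (V : G →ₗ[ℝ] G) : K →ₗ[ℝ] K :=
  K.orthogonalProjectionOnto.toLinearMap ∘ₗ V ∘ₗ K.subtype

variable (K : Submodule ℝ G)

lemma inner_compression (V : G →ₗ[ℝ] G) (x y : K) :
    ⟪compression K V x, y⟫ = ⟪V (x : G), (y : G)⟫ :=
  K.inner_orthogonalProjectionOnto_eq_of_mem_right y _

lemma PosDef.compression {V : G →ₗ[ℝ] G} (hV : PosDef V) : PosDef (compression K V) := by
  refine ⟨fun x y => ?_, fun x hx => ?_⟩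
  · rw [inner_compression, real_inner_comm (FRBL.compression K V y) x, inner_compression,
      real_inner_comm]
    exact (real_inner_comm _ _).trans (hV.1 _ _) |>.trans (real_inner_comm _ _)
  · rw [inner_compression]
    exact hV.2 _ (by simpa using hx)

/-- The shear `z ↦ z + r (π z)` along `K`, where `π` is the projection onto `Kᗮ`. -/
def shear (r : Kᗮ →ₗ[ℝ] K) : G →ₗ[ℝ] G :=
  LinearMap.id + K.subtype ∘ₗ r ∘ₗ Kᗮ.orthogonalProjectionOnto.toLinearMap

variable {K}

lemma shear_apply_coe (r : Kᗮ →ₗ[ℝ] K) (x : Kᗮ) : shear K r x = x + r x := by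
  simp [shear]

lemma shear_apply_mem (r : Kᗮ →ₗ[ℝ] K) {y : G} (hy : y ∈ K) : shear K r y = y := by
  simp [shear, Submodule.orthogonalProjectionOnto_orthogonal_apply_eq_zero hy]

lemma det_shear (r : Kᗮ →ₗ[ℝ] K) : LinearMap.det (shear K r) = 1 := by
  have h : K ≤ K.comap (shear K r) := fun y hy => by
    rw [Submodule.mem_comap, shear_apply_mem r hy]
    exact hy
  have h1 : (shear K r).restrict h = LinearMap.id := by
    ext y
    exact shear_apply_mem r y.2
  have h2 : K.mapQ K (shear K r) h = LinearMap.id := by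
    ext y
    simp [shear]
  rw [LinearMap.det_eq_det_mul_det K _ h, h1, h2, LinearMap.det_id, LinearMap.det_id, one_mul]

lemma det_mapQ_orthogonal {W : G →ₗ[ℝ] G} (h : Kᗮ ≤ Kᗮ.comap W) :
    LinearMap.det (Kᗮ.mapQ Kᗮ W h) = LinearMap.det (compression K W) := by
  have hK : IsCompl Kᗮ K := K.isCompl_orthogonal.symm
  rw [← LinearMap.det_conj (compression K W) (Kᗮ.quotientEquivOfIsCompl K hK).symm]
  congr 1
  refine LinearMap.ext fun q => ?_
  obtain ⟨y, rfl⟩ := (Kᗮ.quotientEquivOfIsCompl K hK).symm.surjective q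
  simp only [LinearMap.comp_apply, LinearEquiv.coe_coe, LinearEquiv.symm_symm,
    LinearEquiv.apply_symm_apply]
  simp only [Submodule.quotientEquivOfIsCompl_symm_apply, Submodule.mapQ_apply]
  exact (Submodule.Quotient.eq _).2 (K.sub_starProjection_mem_orthogonal (W y))

/-- Block decomposition of a positive definite operator by means of its Schur complement. -/
lemma PosDef.exists_schur (K : Submodule ℝ G) {V : G →ₗ[ℝ] G} (hV : PosDef V) :
    ∃ (A : K →ₗ[ℝ] K) (S : Kᗮ →ₗ[ℝ] Kᗮ) (r : Kᗮ →ₗ[ℝ] K), PosDef A ∧ PosDef S ∧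
      Real.log (LinearMap.det V) = Real.log (LinearMap.det A) + Real.log (LinearMap.det S) ∧
      ∀ (x : Kᗮ) (y : K), ⟪V (x + y), (x + y : G)⟫ = ⟪S x, x⟫ + ⟪A (y - r x), y - r x⟫ := by
  have hA := hV.compression K
  set A := FRBL.compression K V with hAdef
  let Ae := LinearEquiv.ofInjectiveEndo A hA.injective
  let r : Kᗮ →ₗ[ℝ] K :=
    -(Ae.symm.toLinearMap ∘ₗ K.orthogonalProjectionOnto.toLinearMap ∘ₗ V ∘ₗ Kᗮ.subtype)
  have hr : ∀ x : Kᗮ, A (r x) = -K.orthogonalProjectionOnto (V x) := fun x => by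
    have : A (Ae.symm (K.orthogonalProjectionOnto (V x))) = K.orthogonalProjectionOnto (V x) :=
      Ae.apply_symm_apply _
    simp [r, this]
  have hmem : ∀ x : Kᗮ, V (x + r x) ∈ Kᗮ := fun x => by
    rw [← Submodule.orthogonalProjectionOnto_eq_zero_iff, map_add, map_add]
    have : K.orthogonalProjectionOnto (V (r x)) = A (r x) := rfl
    rw [this, hr, add_neg_cancel]
  have hW : Kᗮ ≤ Kᗮ.comap (V ∘ₗ shear K r) := fun x hx => by
    rw [Submodule.mem_comap, LinearMap.comp_apply, shear_apply_coe r ⟨x, hx⟩]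
    exact hmem ⟨x, hx⟩
  let S : Kᗮ →ₗ[ℝ] Kᗮ := (V ∘ₗ shear K r).restrict hW
  have hScoe : ∀ x : Kᗮ, (S x : G) = V (x + r x) := fun x =>
    congrArg V (shear_apply_coe r x)
  have horth : ∀ (x : Kᗮ) (y : K), ⟪V (x + r x), (y : G)⟫ = 0 := fun x y =>
    Submodule.inner_left_of_mem_orthogonal y.2 (hmem x)
  have hSin : ∀ x x' : Kᗮ, ⟪S x, x'⟫ = ⟪V (x + r x), (x' + r x' : G)⟫ := fun x x' => by
    rw [inner_add_right, horth, add_zero, ← hScoe]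
    rfl
  have hS : PosDef S := by
    refine ⟨fun x x' => ?_, fun x hx => ?_⟩
    · rw [hSin, real_inner_comm (S x') x, hSin, real_inner_comm]
      exact (real_inner_comm _ _).trans (hV.1 _ _) |>.trans (real_inner_comm _ _)
    · rw [hSin]
      refine hV.2 _ fun h0 => hx ?_
      have : (x : G) = ((-r x : K) : G) := by
        push_cast
        exact eq_neg_of_add_eq_zero_left h0
      have h3 : ⟪(x : G), (x : G)⟫ = 0 := by
        nth_rewrite 1 [this]
        exact Submodule.inner_right_of_mem_orthogonal (-r x).2 x.2
      simpa using h3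
  refine ⟨A, S, r, hA, hS, ?_, fun x y => ?_⟩
  · rw [← Real.log_mul hA.det_ne_zero hS.det_ne_zero]
    congr 1
    have h1 := LinearMap.det_eq_det_mul_det Kᗮ (V ∘ₗ shear K r) hW
    rw [det_mapQ_orthogonal, LinearMap.det_comp, det_shear, mul_one] at h1
    have h2 : FRBL.compression K (V ∘ₗ shear K r) = A := by
      ext y
      simp [hAdef, FRBL.compression, shear_apply_mem r y.2]
    rw [h1, h2, mul_comm]
  · have hdec : (x + y : G) = (x + r x) + ((y - r x : K) : G) := by
      push_cast
      abel
    have hz := horth x (y - r x)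
    have hss := hSin x x
    have hsymm := hV.1 ((y - r x : K) : G) (x + r x)
    have hAin := inner_compression K V (y - r x) (y - r x)
    rw [hdec]
    generalize (x + r x : G) = u at *
    rw [map_add, inner_add_left, inner_add_right, inner_add_right, hsymm, real_inner_comm (V u),
      hz, ← hss, hAdef, hAin]
    ring

end SchurComplement

section Gaussian

variable {c : Fin k → ℝ} {d : Fin m → ℝ} {B : ∀ i j, E i →ₗ[ℝ] F j}
variable {E F}
variable {P : ∀ i, Submodule ℝ (E i)} {Q : ∀ j, Submodule ℝ (F j)}
  {BT : ∀ i j, P i →ₗ[ℝ] Q j} {BQ : ∀ i j, (P i)ᗮ →ₗ[ℝ] (Q j)ᗮ}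

set_option linter.unusedSectionVars false in
lemma Dg_le_add (hd : ∀ j, 0 < d j)
    (hBT : ∀ i j (x : P i), (BT i j x : F j) = B i j (x : E i))
    (hBQ : ∀ i j (x : (P i)ᗮ), B i j (x : E i) - (BQ i j x : F j) ∈ Q j) :
    Dg E F c d B ≤ Dg (fun i => P i) (fun j => Q j) c d BT +
      Dg (fun i => (P i)ᗮ) (fun j => (Q j)ᗮ) c d BQ := by
  refine sSup_le ?_
  rintro _ ⟨V, U, hV, hU, hcon, rfl⟩
  choose A S r hA hS hlog hq using fun i => (hV i).exists_schur (P i)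
  choose A' S' r' hA' hS' hlog' hq' using fun j => (hU j).exists_schur (Q j)
  have hobj : gaussObj E F c d V U = gaussObj (fun i => P i) (fun j => Q j) c d A A' +
      gaussObj (fun i => (P i)ᗮ) (fun j => (Q j)ᗮ) c d S S' := by
    simp only [gaussObj, hlog, hlog', mul_add, Finset.sum_add_distrib]
    ring
  have hqP : ∀ i (y : P i), ⟪V i y, (y : E i)⟫ = ⟪A i y, y⟫ := fun i y => by
    simpa using hq i 0 y
  have hqQ : ∀ j (y : Q j), ⟪U j y, (y : F j)⟫ = ⟪A' j y, y⟫ := fun j y => by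
    simpa using hq' j 0 y
  rw [hobj, EReal.coe_add]
  refine add_le_add (le_sSup ⟨A, A', hA, hA', fun y => ?_, rfl⟩)
    (le_sSup ⟨S, S', hS, hS', fun x => ?_, rfl⟩)
  · have hsum : ∀ j, ∑ i, c i • B i j (y i) = ((∑ i, c i • BT i j (y i) : Q j) : F j) := by
      intro j
      push_cast
      simp only [hBT]
    simpa only [hsum, hqP, hqQ] using hcon fun i => y i
  · have hw : ∀ j, ∑ i, c i • B i j (x i + r i (x i)) -
        ((∑ i, c i • BQ i j (x i) : (Q j)ᗮ) : F j) ∈ Q j := by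
      intro j
      push_cast
      rw [← Finset.sum_sub_distrib]
      refine Submodule.sum_mem _ fun i _ => ?_
      rw [← smul_sub, map_add, add_sub_right_comm, ← hBT]
      exact Submodule.smul_mem _ _ (Submodule.add_mem _ (hBQ i j (x i)) (BT i j _).2)
    refine le_trans (Finset.sum_le_sum fun j _ => mul_le_mul_of_nonneg_left ?_ (hd j).le)
      ((hcon fun i => x i + r i (x i)).trans_eq ?_)
    · have h := hq' j (∑ i, c i • BQ i j (x i)) ⟨_, hw j⟩
      rw [add_sub_cancel] at h
      rw [h]
      exact le_add_of_nonneg_right ((hA' j).inner_self_nonneg _)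
    · refine Finset.sum_congr rfl fun i _ => ?_
      rw [hq, sub_self]
      simp

end Gaussian

/-- **Lemma (subadditivity under decomposition).** For any product-form subspace
`T ⊆ E₀`, `D(c,d,B) ≤ D(c,d,B_T) + D(c,d,B_{E₀/T})`, and likewise for `D_g`. -/
theorem D_subadditive
    (c : Fin k → ℝ) (d : Fin m → ℝ) (B : ∀ i j, E i →ₗ[ℝ] F j)
    (hc : ∀ i, 0 < c i) (hd : ∀ j, 0 < d j)
    (T : Submodule ℝ (PiLp 2 E)) (hT : ProductForm E T)
    -- the restricted datum `B_T`
    (BT : ∀ i j, ↥(T.map (projL E i)) →ₗ[ℝ] ↥(T.map (Bop E F B j)))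
    (hBT : ∀ i j (x : ↥(T.map (projL E i))), (BT i j x : F j) = B i j (x : E i))
    -- the quotient datum `B_{E₀/T}`
    (BQ : ∀ i j, ↥((T.map (projL E i))ᗮ) →ₗ[ℝ] ↥((T.map (Bop E F B j))ᗮ))
    (hBQ : ∀ i j (x : ↥((T.map (projL E i))ᗮ)),
      B i j (x : E i) - (BQ i j x : F j) ∈ T.map (Bop E F B j)) :
    D E F c d B ≤
      D (fun i => ↥(T.map (projL E i))) (fun j => ↥(T.map (Bop E F B j))) c d BT +
      D (fun i => ↥((T.map (projL E i))ᗮ)) (fun j => ↥((T.map (Bop E F B j))ᗮ)) c d BQ ∧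
    Dg E F c d B ≤
      Dg (fun i => ↥(T.map (projL E i))) (fun j => ↥(T.map (Bop E F B j))) c d BT +
      Dg (fun i => ↥((T.map (projL E i))ᗮ)) (fun j => ↥((T.map (Bop E F B j))ᗮ)) c d BQ := by
  exact ⟨D_le_add hc hd hBT hBQ, Dg_le_add hd hBT hBQ⟩

end FRBL
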